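/- arXiv:1603.03324 — 2 statements merged into one kernel-verified Lean document; each statement's English description precedes it below -/
import Mathlib

section
/- Let 𝔫 ⊆ S be the two-sided ideal generated by x and y. Every simple left S-module is isomorphic to S/𝔫; in particular, S has exactly one isomorphism class of simple left modules, and every simple left S-module has length one as an R-module. -/
set_option synthInstance.maxHeartbeats 1000000
set_option maxHeartbeats 2000000
noncomputable section
abbrev R : Type := MvPowerSeries (Fin 2) ℂ
abbrev u : R := MvPowerSeries.X 0
abbrev v : R := MvPowerSeries.X 1

/-- The defining relations of `S = R⟨x,y⟩/(x^e−u, y^e−v, yx−ζxy)`. -/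
inductive Srel (e : ℕ) (ζ : ℂ) : FreeAlgebra R (Fin 2) → FreeAlgebra R (Fin 2) → Prop
  | xe : Srel e ζ (FreeAlgebra.ι R (0 : Fin 2) ^ e) (algebraMap R _ u)
  | ye : Srel e ζ (FreeAlgebra.ι R (1 : Fin 2) ^ e) (algebraMap R _ v)
  | comm : Srel e ζ (FreeAlgebra.ι R (1 : Fin 2) * FreeAlgebra.ι R (0 : Fin 2))
      (algebraMap R _ (algebraMap ℂ R ζ) * (FreeAlgebra.ι R (0 : Fin 2) * FreeAlgebra.ι R (1 : Fin 2)))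

/-- The `R`-algebra `S`. -/
abbrev Salg (e : ℕ) (ζ : ℂ) : Type := RingQuot (Srel e ζ)

/-- The generator `x ∈ S`. -/
def xS (e : ℕ) (ζ : ℂ) : Salg e ζ := RingQuot.mkAlgHom R (Srel e ζ) (FreeAlgebra.ι R 0)

/-- The generator `y ∈ S`. -/
def yS (e : ℕ) (ζ : ℂ) : Salg e ζ := RingQuot.mkAlgHom R (Srel e ζ) (FreeAlgebra.ι R 1)


/-- `M` has finite length `l` as an `R₀`-module, expressed by the existence of a
composition series from `⊥` to `⊤` of length `l`. -/
def lengthEq (R₀ : Type) (M : Type) [Ring R₀] [AddCommGroup M] [Module R₀ M] (l : ℕ) : Prop :=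
  ∃ s : CompositionSeries (Submodule R₀ M), s.head = ⊥ ∧ s.last = ⊤ ∧ s.length = l

/-- `𝔫 ⊆ S`, the two-sided ideal generated by `x` and `y`, viewed as a left ideal. -/
def nIdeal (e : ℕ) (ζ : ℂ) : Ideal (Salg e ζ) :=
  TwoSidedIdeal.asIdeal (TwoSidedIdeal.span {xS e ζ, yS e ζ})

/-- Shortcut instance to help typeclass resolution for quotients of `S`. -/
@[reducible] instance hasQuotSalg (e : ℕ) (ζ : ℂ) :
    HasQuotient (Salg e ζ) (Ideal (Salg e ζ)) :=
  @Submodule.hasQuotient (Salg e ζ) (Salg e ζ) (RingQuot.instRing (Srel e ζ))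
    inferInstance inferInstance

/-!
STATEMENT 15: Every simple left `S`-module is isomorphic to `S/𝔫`; in particular `S` has
exactly one isomorphism class of simple left modules, and every simple left `S`-module has
length one as an `R`-module.
-/

section QuantumPlane

variable {k A : Type*} [CommRing k] [Ring A] [Algebra k A]

/-- If `a` commutes past each generator of `A` up to changing the generator, it commutes past
every element of `A` in the same sense. -/
theorem exists_mul_eq_mul_of_adjoin_eq_top {s : Set A} (hs : Algebra.adjoin k s = ⊤) {a : A}
    (h : ∀ g ∈ s, ∃ g', g * a = a * g') (b : A) : ∃ b', b * a = a * b' := by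
  have hb : b ∈ Algebra.adjoin k s := hs ▸ Algebra.mem_top
  induction hb using Algebra.adjoin_induction with
  | mem g hg => exact h g hg
  | algebraMap r => exact ⟨algebraMap k A r, Algebra.commutes r a⟩
  | add p q _ _ hp hq =>
    obtain ⟨p', hp⟩ := hp
    obtain ⟨q', hq⟩ := hq
    exact ⟨p' + q', by rw [add_mul, mul_add, hp, hq]⟩
  | mul p q _ _ hp hq =>
    obtain ⟨p', hp⟩ := hp
    obtain ⟨q', hq⟩ := hq
    exact ⟨p' * q', by rw [mul_assoc, hq, ← mul_assoc, hp, mul_assoc]⟩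

/-- An algebra generated by two integral elements which commute up to a scalar is a finite
module. -/
theorem module_finite_of_skew_commute {x y : A} {q : k} (hxy : y * x = q • (x * y))
    (hgen : Algebra.adjoin k {x, y} = ⊤) (hx : IsIntegral k x) (hy : IsIntegral k y) :
    Module.Finite k A := by
  have hmove : ∀ a ∈ Algebra.adjoin k {x}, ∃ a' ∈ Algebra.adjoin k {x}, y * a = a' * y := by
    intro a ha
    induction ha using Algebra.adjoin_induction with
    | mem g hg =>
      obtain rfl : g = x := hg
      exact ⟨q • g, Subalgebra.smul_mem _ (Algebra.self_mem_adjoin_singleton k g) q,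
        by rw [hxy, smul_mul_assoc]⟩
    | algebraMap r =>
      exact ⟨algebraMap k A r, Subalgebra.algebraMap_mem _ r, (Algebra.commutes r y).symm⟩
    | add a b _ _ ha hb =>
      obtain ⟨a', ha', ha⟩ := ha
      obtain ⟨b', hb', hb⟩ := hb
      exact ⟨a' + b', add_mem ha' hb', by rw [mul_add, add_mul, ha, hb]⟩
    | mul a b _ _ ha hb =>
      obtain ⟨a', ha', ha⟩ := ha
      obtain ⟨b', hb', hb⟩ := hb
      exact ⟨a' * b', mul_mem ha' hb', by rw [← mul_assoc, ha, mul_assoc, hb, mul_assoc]⟩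
  set P : Submodule k A :=
    Subalgebra.toSubmodule (Algebra.adjoin k {x}) * Subalgebra.toSubmodule (Algebra.adjoin k {y})
  have hleft : ∀ s : A, ∀ p ∈ P, s * p ∈ P := by
    intro s
    have hs : s ∈ Algebra.adjoin k {x, y} := hgen ▸ Algebra.mem_top
    induction hs using Algebra.adjoin_induction with
    | mem g hg =>
      intro p hp
      induction hp using Submodule.mul_induction_on' with
      | mem_mul_mem a ha b hb =>
        rcases hg with rfl | rfl
        · rw [← mul_assoc]
          exact Submodule.mul_mem_mul
            (Subalgebra.mul_mem _ (Algebra.self_mem_adjoin_singleton k g) ha) hb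
        · obtain ⟨a', ha', h⟩ := hmove a ha
          rw [← mul_assoc, h, mul_assoc]
          exact Submodule.mul_mem_mul ha'
            (Subalgebra.mul_mem _ (Algebra.self_mem_adjoin_singleton k g) hb)
      | add p _ p' _ hp hp' => exact mul_add g p p' ▸ add_mem hp hp'
    | algebraMap r =>
      intro p hp
      exact Algebra.smul_def r p ▸ P.smul_mem r hp
    | add s t _ _ hs ht =>
      intro p hp
      exact add_mul s t p ▸ add_mem (hs p hp) (ht p hp)
    | mul s t _ _ hs ht =>
      intro p hp
      exact mul_assoc s t p ▸ hs _ (ht p hp)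
  have htop : P = ⊤ := by
    refine eq_top_iff.mpr fun s _ => ?_
    have h1 : (1 : A) ∈ P :=
      mul_one (1 : A) ▸ Submodule.mul_mem_mul (one_mem (Algebra.adjoin k {x}))
        (one_mem (Algebra.adjoin k {y}))
    exact mul_one s ▸ hleft s 1 h1
  exact ⟨htop ▸ hx.fg_adjoin_singleton.mul hy.fg_adjoin_singleton⟩

theorem isIntegral_of_pow_eq_algebraMap {x : A} {e : ℕ} (he : e ≠ 0) {w : k}
    (h : x ^ e = algebraMap k A w) : IsIntegral k x :=
  ⟨Polynomial.X ^ e - Polynomial.C w, Polynomial.monic_X_pow_sub_C w he, by simp [h]⟩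

/-- An element of a finite algebra over a local ring which has a power in the maximal ideal, and
which commutes past all elements up to changing them, annihilates all simple modules. -/
theorem smul_eq_zero_of_isSimpleModule [IsLocalRing k] [Module.Finite k A] {a : A}
    (ha : ∀ b : A, ∃ b', b * a = a * b') {e : ℕ} {w : k} (hw : w ∈ IsLocalRing.maximalIdeal k)
    (hae : a ^ e = algebraMap k A w) {M : Type*} [AddCommGroup M] [Module A M] [Module k M]
    [IsScalarTower k A M] [IsSimpleModule A M] (m : M) : a • m = 0 := by
  have : Nontrivial M := IsSimpleModule.nontrivial A M
  have : Module.Finite k M := Module.Finite.trans A M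
  let N : Submodule A M :=
    { carrier := Set.range fun m : M => a • m
      zero_mem' := ⟨0, smul_zero a⟩
      add_mem' := by
        rintro _ _ ⟨p, rfl⟩ ⟨q, rfl⟩
        exact ⟨p + q, smul_add a p q⟩
      smul_mem' := by
        rintro b _ ⟨p, rfl⟩
        obtain ⟨b', hb'⟩ := ha b
        exact ⟨b' • p, by simp only [smul_smul, hb']⟩ }
  rcases eq_bot_or_eq_top N with hN | hN
  · have hm : a • m ∈ N := ⟨m, rfl⟩
    rwa [hN, Submodule.mem_bot] at hm
  · exfalso
    have hpow : ∀ n : ℕ, ∀ p : M, ∃ p' : M, a ^ n • p' = p := by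
      intro n
      induction n with
      | zero => exact fun p => ⟨p, by simp⟩
      | succ n ih =>
        intro p
        obtain ⟨p', rfl⟩ := ih p
        obtain ⟨p'', hp''⟩ : p' ∈ N := hN ▸ Submodule.mem_top
        exact ⟨p'', by rw [pow_succ, mul_smul]; exact congrArg _ hp''⟩
    refine top_ne_bot (Submodule.eq_bot_of_le_smul_of_le_jacobson_bot
      (IsLocalRing.maximalIdeal k) (⊤ : Submodule k M) Module.Finite.fg_top (fun p _ => ?_)
      (IsLocalRing.maximalIdeal_le_jacobson ⊥))
    obtain ⟨p', rfl⟩ := hpow e p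
    rw [hae, algebraMap_smul]
    exact Submodule.smul_mem_smul hw Submodule.mem_top

theorem exists_algebraMap_add_of_adjoin_eq_top {s : Set A} (hs : Algebra.adjoin k s = ⊤) (b : A) :
    ∃ r : k, ∃ n ∈ TwoSidedIdeal.span s, b = algebraMap k A r + n := by
  have hb : b ∈ Algebra.adjoin k s := hs ▸ Algebra.mem_top
  induction hb using Algebra.adjoin_induction with
  | mem g hg => exact ⟨0, g, TwoSidedIdeal.subset_span hg, by simp⟩
  | algebraMap r => exact ⟨r, 0, zero_mem _, by simp⟩
  | add p q _ _ hp hq =>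
    obtain ⟨r, n, hn, rfl⟩ := hp
    obtain ⟨r', n', hn', rfl⟩ := hq
    exact ⟨r + r', n + n', add_mem hn hn', by rw [map_add]; abel⟩
  | mul p q _ _ hp hq =>
    obtain ⟨r, n, hn, rfl⟩ := hp
    obtain ⟨r', n', hn', rfl⟩ := hq
    refine ⟨r * r', algebraMap k A r * n' + n * (algebraMap k A r' + n'),
      add_mem (TwoSidedIdeal.mul_mem_left _ _ _ hn') (TwoSidedIdeal.mul_mem_right _ _ _ hn), ?_⟩
    rw [map_mul]
    noncomm_ring

theorem smul_eq_zero_of_mem_twoSidedIdeal_span {M : Type*} [AddCommGroup M] [Module A M]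
    {s : Set A} (h : ∀ a ∈ s, ∀ m : M, a • m = 0) {n : A} (hn : n ∈ TwoSidedIdeal.span s)
    (m : M) : n • m = 0 := by
  induction hn using TwoSidedIdeal.span_induction generalizing m with
  | mem a ha => exact h a ha m
  | zero => exact zero_smul A m
  | add a b _ _ ha hb => rw [add_smul, ha, hb, add_zero]
  | neg a _ ha => rw [neg_smul, ha, neg_zero]
  | left_absorb a b _ hb => rw [mul_smul, hb, smul_zero]
  | right_absorb a b _ hb => rw [mul_smul, hb]

theorem isSimpleModule_of_generators_smul_eq_zero {s : Set A}
    (hs : Algebra.adjoin k s = ⊤) {M : Type*} [AddCommGroup M] [Module A M] [Module k M]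
    [IsScalarTower k A M] [IsSimpleModule A M] (hann : ∀ a ∈ s, ∀ m : M, a • m = 0) :
    IsSimpleModule k M := by
  refine isSimpleModule_iff_toSpanSingleton_surjective.mpr
    ⟨IsSimpleModule.nontrivial A M, fun m hm p => ?_⟩
  obtain ⟨b, rfl⟩ := IsSimpleModule.toSpanSingleton_surjective A hm p
  obtain ⟨r, n, hn, rfl⟩ := exists_algebraMap_add_of_adjoin_eq_top hs b
  refine ⟨r, ?_⟩
  simp [add_smul, smul_eq_zero_of_mem_twoSidedIdeal_span hann hn]

theorem nonempty_linearEquiv_quotient_span_of_generators_smul_eq_zero [IsLocalRing k] {s : Set A}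
    (hs : Algebra.adjoin k s = ⊤) {M : Type*} [AddCommGroup M] [Module A M] [Module k M]
    [IsScalarTower k A M] [IsSimpleModule A M] (hann : ∀ a ∈ s, ∀ m : M, a • m = 0)
    (hmax : ∀ r ∈ IsLocalRing.maximalIdeal k, algebraMap k A r ∈ TwoSidedIdeal.span s) :
    Nonempty (M ≃ₗ[A] A ⧸ TwoSidedIdeal.asIdeal (TwoSidedIdeal.span s)) := by
  have : Nontrivial M := IsSimpleModule.nontrivial A M
  obtain ⟨m, hm⟩ := exists_ne (0 : M)
  have hker : LinearMap.ker (LinearMap.toSpanSingleton A M m) =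
      TwoSidedIdeal.asIdeal (TwoSidedIdeal.span s) := by
    ext b
    rw [LinearMap.mem_ker, LinearMap.toSpanSingleton_apply, TwoSidedIdeal.mem_asIdeal]
    refine ⟨fun hb => ?_, fun hb => smul_eq_zero_of_mem_twoSidedIdeal_span hann hb m⟩
    obtain ⟨r, n, hn, rfl⟩ := exists_algebraMap_add_of_adjoin_eq_top hs b
    rw [add_smul, smul_eq_zero_of_mem_twoSidedIdeal_span hann hn, add_zero, algebraMap_smul] at hb
    refine add_mem (hmax r ?_) hn
    rw [IsLocalRing.mem_maximalIdeal, mem_nonunits_iff]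
    intro hr
    exact hm (hr.smul_eq_zero.mp hb)
  exact ⟨((Submodule.quotEquivOfEq _ _ hker).symm.trans (LinearMap.quotKerEquivOfSurjective _
    (IsSimpleModule.toSpanSingleton_surjective A hm))).symm⟩

/-- On a simple module over an algebra generated by skew-commuting roots of elements of the
maximal ideal, the two generators act as zero. -/
theorem generators_smul_eq_zero_of_skew_commute [IsLocalRing k] {x y : A} {q : k} (hq : IsUnit q)
    (hxy : y * x = q • (x * y)) (hgen : Algebra.adjoin k {x, y} = ⊤) {e : ℕ} (he : e ≠ 0)
    {a b : k} (ha : a ∈ IsLocalRing.maximalIdeal k) (hb : b ∈ IsLocalRing.maximalIdeal k)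
    (hx : x ^ e = algebraMap k A a) (hy : y ^ e = algebraMap k A b)
    {M : Type*} [AddCommGroup M] [Module A M] [Module k M] [IsScalarTower k A M]
    [IsSimpleModule A M] : ∀ g ∈ ({x, y} : Set A), ∀ m : M, g • m = 0 := by
  have : Module.Finite k A := module_finite_of_skew_commute hxy hgen
    (isIntegral_of_pow_eq_algebraMap he hx) (isIntegral_of_pow_eq_algebraMap he hy)
  rintro g (rfl | rfl) m
  · refine smul_eq_zero_of_isSimpleModule (exists_mul_eq_mul_of_adjoin_eq_top hgen ?_) ha hx m
    rintro h (rfl | rfl)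
    · exact ⟨h, rfl⟩
    · exact ⟨q • h, by rw [hxy, mul_smul_comm]⟩
  · refine smul_eq_zero_of_isSimpleModule (exists_mul_eq_mul_of_adjoin_eq_top hgen ?_) hb hy m
    rintro h (rfl | rfl)
    · obtain ⟨c, rfl⟩ := hq
      refine ⟨(↑c⁻¹ : k) • h, ?_⟩
      rw [mul_smul_comm, hxy, smul_smul, Units.inv_mul, one_smul]
    · exact ⟨h, rfl⟩

end QuantumPlane

theorem exists_eq_u_mul_add_v_mul {r : R} (hr : MvPowerSeries.constantCoeff r = 0) :
    ∃ a b : R, r = u * a + v * b := by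
  classical
  let p : R := fun n => if n 0 = 0 then 0 else MvPowerSeries.coeff n r
  have hp : ∀ n, MvPowerSeries.coeff n p = if n 0 = 0 then 0 else MvPowerSeries.coeff n r :=
    fun _ => rfl
  obtain ⟨a, ha⟩ : u ∣ p := MvPowerSeries.X_dvd_iff.mpr fun n hn => by rw [hp, if_pos hn]
  obtain ⟨b, hb⟩ : v ∣ r - p := by
    refine MvPowerSeries.X_dvd_iff.mpr fun n hn => ?_
    rw [map_sub, hp]
    split_ifs with h0
    · obtain rfl : n = 0 := by
        ext i
        fin_cases i
        · exact h0
        · exact hn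
      simpa using hr
    · exact sub_self _
  exact ⟨a, b, by rw [← ha, ← hb]; ring⟩

theorem mem_maximalIdeal_R_iff {r : R} :
    r ∈ IsLocalRing.maximalIdeal R ↔ MvPowerSeries.constantCoeff r = 0 := by
  rw [IsLocalRing.mem_maximalIdeal, mem_nonunits_iff, MvPowerSeries.isUnit_iff_constantCoeff,
    isUnit_iff_ne_zero, not_not]

section Salg

variable (e : ℕ) (ζ : ℂ)

theorem xS_pow : xS e ζ ^ e = algebraMap R (Salg e ζ) u := by
  rw [xS, ← map_pow, RingQuot.mkAlgHom_rel R Srel.xe, AlgHom.commutes]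

theorem yS_pow : yS e ζ ^ e = algebraMap R (Salg e ζ) v := by
  rw [yS, ← map_pow, RingQuot.mkAlgHom_rel R Srel.ye, AlgHom.commutes]

theorem yS_mul_xS : yS e ζ * xS e ζ = algebraMap ℂ R ζ • (xS e ζ * yS e ζ) := by
  rw [xS, yS, ← map_mul, RingQuot.mkAlgHom_rel R Srel.comm, map_mul, AlgHom.commutes, map_mul,
    Algebra.smul_def]

theorem adjoin_xS_yS : Algebra.adjoin R {xS e ζ, yS e ζ} = ⊤ := by
  have himage : ({xS e ζ, yS e ζ} : Set (Salg e ζ)) =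
      RingQuot.mkAlgHom R (Srel e ζ) '' Set.range (FreeAlgebra.ι R) := by
    ext s
    simp [xS, yS, Fin.exists_fin_two, eq_comm]
  rw [himage, ← AlgHom.map_adjoin, FreeAlgebra.adjoin_range_ι, Algebra.map_top,
    AlgHom.range_eq_top]
  exact RingQuot.mkAlgHom_surjective R (Srel e ζ)

variable {e ζ}

theorem algebraMap_mem_span_of_mem_maximalIdeal (he : e ≠ 0) {r : R}
    (hr : r ∈ IsLocalRing.maximalIdeal R) :
    algebraMap R (Salg e ζ) r ∈ TwoSidedIdeal.span {xS e ζ, yS e ζ} := by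
  obtain ⟨a, b, rfl⟩ := exists_eq_u_mul_add_v_mul (mem_maximalIdeal_R_iff.mp hr)
  obtain ⟨d, rfl⟩ := Nat.exists_eq_succ_of_ne_zero he
  rw [map_add, map_mul, map_mul, ← xS_pow, ← yS_pow, pow_succ, pow_succ]
  refine add_mem ?_ ?_ <;>
    refine TwoSidedIdeal.mul_mem_right _ _ _ (TwoSidedIdeal.mul_mem_left _ _ _
      (TwoSidedIdeal.subset_span ?_)) <;> simp

theorem xS_yS_smul_eq_zero (he : e ≠ 0) (hζ : ζ ≠ 0) {M : Type*} [AddCommGroup M]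
    [Module (Salg e ζ) M] [Module R M] [IsScalarTower R (Salg e ζ) M]
    [IsSimpleModule (Salg e ζ) M] :
    ∀ g ∈ ({xS e ζ, yS e ζ} : Set (Salg e ζ)), ∀ m : M, g • m = 0 :=
  generators_smul_eq_zero_of_skew_commute (A := Salg e ζ)
    ((isUnit_iff_ne_zero.mpr hζ).map (algebraMap ℂ R))
    (yS_mul_xS e ζ) (adjoin_xS_yS e ζ) he
    (mem_maximalIdeal_R_iff.mpr (MvPowerSeries.constantCoeff_X 0))
    (mem_maximalIdeal_R_iff.mpr (MvPowerSeries.constantCoeff_X 1)) (xS_pow e ζ) (yS_pow e ζ)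

end Salg

theorem lengthEq_one_of_isSimpleModule {k M : Type} [Ring k] [AddCommGroup M] [Module k M]
    [IsSimpleModule k M] : lengthEq k M 1 := by
  let s : CompositionSeries (Submodule k M) := ⟨1, ![⊥, ⊤], fun i => by
    obtain rfl : i = 0 := Subsingleton.elim _ _
    exact (bot_covBy_top : (⊥ : Submodule k M) ⋖ ⊤)⟩
  exact ⟨s, rfl, rfl, rfl⟩

theorem simple_modules_of_Salg (e : ℕ) (he : 1 ≤ e) (ζ : ℂ) (hζ : IsPrimitiveRoot ζ e) :
    (∀ (M : Type) [AddCommGroup M] [Module (Salg e ζ) M],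
      IsSimpleModule (Salg e ζ) M → Nonempty (M ≃ₗ[Salg e ζ] (Salg e ζ ⧸ nIdeal e ζ))) ∧
    (∀ (M : Type) [AddCommGroup M] [Module (Salg e ζ) M]
        [Module R M] [IsScalarTower R (Salg e ζ) M],
      IsSimpleModule (Salg e ζ) M → lengthEq R M 1) := by
  have he0 : e ≠ 0 := Nat.one_le_iff_ne_zero.mp he
  have hζ0 : ζ ≠ 0 := hζ.ne_zero he0
  constructor
  · intro M _ _ _
    let _ : Module R M := Module.compHom M (algebraMap R (Salg e ζ))
    have : IsScalarTower R (Salg e ζ) M :=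
      ⟨fun r s m => by rw [Algebra.smul_def, mul_smul]; rfl⟩
    exact nonempty_linearEquiv_quotient_span_of_generators_smul_eq_zero (adjoin_xS_yS e ζ)
      (xS_yS_smul_eq_zero he0 hζ0) fun r hr => algebraMap_mem_span_of_mem_maximalIdeal he0 hr
  · intro M _ _ _ _ _
    have : IsSimpleModule R M := isSimpleModule_of_generators_smul_eq_zero (A := Salg e ζ)
      (adjoin_xS_yS e ζ) (xS_yS_smul_eq_zero he0 hζ0)
    exact lengthEq_one_of_isSimpleModule

end
end

section
/- Let f ≥ 1 be an integer and A := M_f(S). For a natural number l, there exists a left ideal I ⊆ A such that A/I has finite length l as an R-module if and only if f divides l; moreover, every simple left A-module has length exactly f as an R-module, and any two simple left A-modules are isomorphic. -/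
set_option synthInstance.maxHeartbeats 1000000
set_option maxHeartbeats 2000000
noncomputable section
/-- `A = M_f(S)`. -/
abbrev ASalg (e : ℕ) (ζ : ℂ) (f : ℕ) : Type := Matrix (Fin f) (Fin f) (Salg e ζ)

/-- Shortcut instance to help typeclass resolution for quotients of `A = M_f(S)`. -/
@[reducible] instance hasQuotASalg (e : ℕ) (ζ : ℂ) (f : ℕ) :
    HasQuotient (ASalg e ζ f) (Submodule (ASalg e ζ f) (ASalg e ζ f)) :=
  @Submodule.hasQuotient (ASalg e ζ f) (ASalg e ζ f)
    (@Matrix.instRing (Fin f) (Salg e ζ) _ _ (RingQuot.instRing (Srel e ζ)))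
    inferInstance inferInstance

namespace Salg

variable {e : ℕ} {ζ : ℂ}

theorem xS_pow : xS e ζ ^ e = algebraMap R (Salg e ζ) u := by
  rw [xS, ← map_pow, RingQuot.mkAlgHom_rel R Srel.xe, AlgHom.commutes]

theorem yS_pow : yS e ζ ^ e = algebraMap R (Salg e ζ) v := by
  rw [yS, ← map_pow, RingQuot.mkAlgHom_rel R Srel.ye, AlgHom.commutes]

theorem yS_mul_xS :
    yS e ζ * xS e ζ = algebraMap R (Salg e ζ) (algebraMap ℂ R ζ) * (xS e ζ * yS e ζ) := by
  rw [yS, xS, ← map_mul, RingQuot.mkAlgHom_rel R Srel.comm, map_mul, map_mul, AlgHom.commutes]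

theorem induction {P : Salg e ζ → Prop} (hr : ∀ r : R, P (algebraMap R (Salg e ζ) r))
    (hx : P (xS e ζ)) (hy : P (yS e ζ)) (hadd : ∀ a b, P a → P b → P (a + b))
    (hmul : ∀ a b, P a → P b → P (a * b)) (s : Salg e ζ) : P s := by
  obtain ⟨a, rfl⟩ := RingQuot.mkAlgHom_surjective R (Srel e ζ) s
  induction a using FreeAlgebra.induction with
  | grade0 r => rw [AlgHom.commutes]; exact hr r
  | grade1 i =>
    fin_cases i
    · exact hx
    · exact hy
  | mul a b ha hb => rw [map_mul]; exact hmul _ _ ha hb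
  | add a b ha hb => rw [map_add]; exact hadd _ _ ha hb

theorem yS_mul_xS_pow (i : ℕ) : yS e ζ * xS e ζ ^ i =
    algebraMap R (Salg e ζ) (algebraMap ℂ R ζ ^ i) * (xS e ζ ^ i * yS e ζ) := by
  induction i with
  | zero => simp
  | succ i ih =>
    rw [pow_succ, ← mul_assoc, ih, mul_assoc, mul_assoc, yS_mul_xS, pow_succ, map_mul,
      ← mul_assoc (xS e ζ ^ i), ← Algebra.commutes _ (xS e ζ ^ i)]
    simp only [mul_assoc]

/-- The `R`-span of the monomials `xⁱyʲ` with `i, j < e`. -/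
def monomialSpan (e : ℕ) (ζ : ℂ) : Submodule R (Salg e ζ) :=
  Submodule.span R (Set.range fun p : Fin e × Fin e => xS e ζ ^ (p.1 : ℕ) * yS e ζ ^ (p.2 : ℕ))

theorem monomial_mem (he : 1 ≤ e) (i j : ℕ) :
    xS e ζ ^ i * yS e ζ ^ j ∈ monomialSpan e ζ := by
  have h : xS e ζ ^ i * yS e ζ ^ j =
      (u ^ (i / e) * v ^ (j / e)) • (xS e ζ ^ (i % e) * yS e ζ ^ (j % e)) := by
    conv_lhs => rw [← Nat.div_add_mod i e, ← Nat.div_add_mod j e]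
    rw [pow_add, pow_add, pow_mul, pow_mul, xS_pow, yS_pow, ← map_pow, ← map_pow,
      Algebra.smul_def, map_mul, mul_assoc, mul_assoc, ← mul_assoc (xS e ζ ^ (i % e)),
      ← Algebra.commutes _ (xS e ζ ^ (i % e))]
    simp only [mul_assoc]
  rw [h]
  exact Submodule.smul_mem _ _ (Submodule.subset_span
    ⟨(⟨i % e, Nat.mod_lt _ he⟩, ⟨j % e, Nat.mod_lt _ he⟩), rfl⟩)

theorem monomialSpan_eq_top (he : 1 ≤ e) : monomialSpan e ζ = ⊤ := by
  have key : ∀ s w : Salg e ζ, w ∈ monomialSpan e ζ → s * w ∈ monomialSpan e ζ := by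
    intro s
    induction s using Salg.induction with
    | hr r =>
      intro w hw
      rw [← Algebra.smul_def]
      exact Submodule.smul_mem _ _ hw
    | hx =>
      intro w hw
      induction hw using Submodule.span_induction with
      | mem w hw =>
        obtain ⟨p, rfl⟩ := hw
        simp only [← mul_assoc, ← pow_succ']
        exact monomial_mem he _ _
      | zero => simp
      | add a b _ _ ha hb => rw [mul_add]; exact add_mem ha hb
      | smul r a _ ha => rw [mul_smul_comm]; exact Submodule.smul_mem _ _ ha
    | hy =>
      intro w hw
      induction hw using Submodule.span_induction with
      | mem w hw =>
        obtain ⟨p, rfl⟩ := hw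
        simp only [← mul_assoc, yS_mul_xS_pow]
        simp only [mul_assoc, ← pow_succ']
        rw [← Algebra.smul_def]
        exact Submodule.smul_mem _ _ (monomial_mem he _ _)
      | zero => simp
      | add a b _ _ ha hb => rw [mul_add]; exact add_mem ha hb
      | smul r a _ ha => rw [mul_smul_comm]; exact Submodule.smul_mem _ _ ha
    | hadd a b ha hb => intro w hw; rw [add_mul]; exact add_mem (ha w hw) (hb w hw)
    | hmul a b ha hb => intro w hw; rw [mul_assoc]; exact ha _ (hb w hw)
  refine eq_top_iff.2 fun s _ => ?_
  have h1 : (1 : Salg e ζ) ∈ monomialSpan e ζ := by simpa using monomial_mem (ζ := ζ) he 0 0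
  simpa using key s 1 h1

theorem finite (he : 1 ≤ e) : Module.Finite R (Salg e ζ) :=
  ⟨by
    rw [← monomialSpan_eq_top he]
    exact Submodule.fg_span (Set.finite_range _)⟩

theorem exists_mul_xS (s : Salg e ζ) : ∃ s', s * xS e ζ = xS e ζ * s' := by
  induction s using Salg.induction with
  | hr r => exact ⟨_, Algebra.commutes _ _⟩
  | hx => exact ⟨_, rfl⟩
  | hy =>
    refine ⟨algebraMap R _ (algebraMap ℂ R ζ) * yS e ζ, ?_⟩
    rw [yS_mul_xS, ← mul_assoc, ← mul_assoc, Algebra.commutes]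
  | hadd a b ha hb =>
    obtain ⟨a', ha⟩ := ha
    obtain ⟨b', hb⟩ := hb
    exact ⟨a' + b', by rw [add_mul, mul_add, ha, hb]⟩
  | hmul a b ha hb =>
    obtain ⟨a', ha⟩ := ha
    obtain ⟨b', hb⟩ := hb
    exact ⟨a' * b', by rw [mul_assoc, hb, ← mul_assoc, ha, mul_assoc]⟩

theorem exists_mul_yS (hζ : ζ ≠ 0) (s : Salg e ζ) : ∃ s', s * yS e ζ = yS e ζ * s' := by
  induction s using Salg.induction with
  | hr r => exact ⟨_, Algebra.commutes _ _⟩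
  | hx =>
    refine ⟨algebraMap R _ (algebraMap ℂ R ζ⁻¹) * xS e ζ, ?_⟩
    rw [← mul_assoc, ← Algebra.commutes, mul_assoc, yS_mul_xS, ← mul_assoc, ← map_mul, ← map_mul,
      inv_mul_cancel₀ hζ, map_one, map_one, one_mul]
  | hy => exact ⟨_, rfl⟩
  | hadd a b ha hb =>
    obtain ⟨a', ha⟩ := ha
    obtain ⟨b', hb⟩ := hb
    exact ⟨a' + b', by rw [add_mul, mul_add, ha, hb]⟩
  | hmul a b ha hb =>
    obtain ⟨a', ha⟩ := ha
    obtain ⟨b', hb⟩ := hb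
    exact ⟨a' * b', by rw [mul_assoc, hb, ← mul_assoc, ha, mul_assoc]⟩

end Salg

open PowerSeries in
theorem hasSubst_X_pow_zero {e : ℕ} (he : 1 ≤ e) :
    MvPowerSeries.HasSubst (![X ^ e, 0] : Fin 2 → ℂ⟦X⟧) :=
  MvPowerSeries.hasSubst_of_constantCoeff_zero fun i => by
    fin_cases i
    · change PowerSeries.constantCoeff (R := ℂ) (X ^ e) = 0
      simp [Nat.one_le_iff_ne_zero.1 he]
    · simp

/-- The substitution `u ↦ tᵉ`, `v ↦ 0`. -/
def substHom (e : ℕ) (he : 1 ≤ e) : R →ₐ[ℂ] PowerSeries ℂ :=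
  MvPowerSeries.substAlgHom (hasSubst_X_pow_zero he)

theorem substHom_u {e : ℕ} (he : 1 ≤ e) : substHom e he u = PowerSeries.X ^ e :=
  MvPowerSeries.substAlgHom_X (hasSubst_X_pow_zero he) 0

theorem substHom_v {e : ℕ} (he : 1 ≤ e) : substHom e he v = 0 :=
  MvPowerSeries.substAlgHom_X (hasSubst_X_pow_zero he) 1

theorem constantCoeff_substHom {e : ℕ} (he : 1 ≤ e) (r : R) :
    PowerSeries.constantCoeff (substHom e he r) = MvPowerSeries.constantCoeff r := by
  by_contra h
  set c := PowerSeries.constantCoeff (substHom e he r)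
  have hu : IsUnit (r - algebraMap ℂ R c) := by
    rw [MvPowerSeries.isUnit_iff_constantCoeff, isUnit_iff_ne_zero]
    simpa [MvPowerSeries.algebraMap_apply, sub_eq_zero] using Ne.symm h
  have := (hu.map (substHom e he)).map (PowerSeries.constantCoeff (R := ℂ))
  rw [isUnit_iff_ne_zero] at this
  apply this
  rw [map_sub, map_sub, AlgHom.commutes]
  simp [c]

namespace Salg

variable {e : ℕ} {ζ : ℂ}

theorem exists_toPowerSeries (e : ℕ) (ζ : ℂ) (he : 1 ≤ e) : ∃ φ : Salg e ζ →+* PowerSeries ℂ,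
    φ (xS e ζ) = PowerSeries.X ∧ φ (yS e ζ) = 0 ∧
      ∀ r, φ (algebraMap R (Salg e ζ) r) = substHom e he r := by
  let : Algebra R (PowerSeries ℂ) := (substHom e he).toRingHom.toAlgebra
  have hA : ∀ r : R, algebraMap R (PowerSeries ℂ) r = substHom e he r := fun r => rfl
  let g : FreeAlgebra R (Fin 2) →ₐ[R] PowerSeries ℂ := FreeAlgebra.lift R ![PowerSeries.X, 0]
  have hg0 : g (FreeAlgebra.ι R 0) = PowerSeries.X := FreeAlgebra.lift_ι_apply _ _
  have hg1 : g (FreeAlgebra.ι R 1) = 0 := FreeAlgebra.lift_ι_apply _ _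
  have hg : ∀ ⦃a b⦄, Srel e ζ a b → g a = g b := by
    intro a b h
    cases h with
    | xe => rw [map_pow, hg0, AlgHom.commutes, hA, substHom_u]
    | ye =>
      rw [map_pow, hg1, AlgHom.commutes, hA, substHom_v, zero_pow (Nat.one_le_iff_ne_zero.1 he)]
    | comm => simp only [map_mul, hg1, zero_mul, mul_zero]
  refine ⟨(RingQuot.liftAlgHom R ⟨g, hg⟩ : Salg e ζ →ₐ[R] PowerSeries ℂ), ?_, ?_, fun r => ?_⟩
  · exact (RingQuot.liftAlgHom_mkAlgHom_apply R g hg _).trans hg0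
  · exact (RingQuot.liftAlgHom_mkAlgHom_apply R g hg _).trans hg1
  · exact (AlgHom.commutes _ r).trans (hA r)

/-- The homomorphism `S → ℂ⟦t⟧` given by `x ↦ t`, `y ↦ 0`. -/
def toPowerSeries (e : ℕ) (ζ : ℂ) (he : 1 ≤ e) : Salg e ζ →+* PowerSeries ℂ :=
  (exists_toPowerSeries e ζ he).choose

theorem toPowerSeries_xS (he : 1 ≤ e) : toPowerSeries e ζ he (xS e ζ) = PowerSeries.X :=
  (exists_toPowerSeries e ζ he).choose_spec.1

theorem toPowerSeries_yS (he : 1 ≤ e) : toPowerSeries e ζ he (yS e ζ) = 0 :=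
  (exists_toPowerSeries e ζ he).choose_spec.2.1

theorem toPowerSeries_algebraMap (he : 1 ≤ e) (r : R) :
    toPowerSeries e ζ he (algebraMap R (Salg e ζ) r) = substHom e he r :=
  (exists_toPowerSeries e ζ he).choose_spec.2.2 r

/-- The residue map `S → ℂ`. -/
def residue (e : ℕ) (ζ : ℂ) (he : 1 ≤ e) : Salg e ζ →+* ℂ :=
  (PowerSeries.constantCoeff (R := ℂ)).comp (toPowerSeries e ζ he)

theorem residue_xS (he : 1 ≤ e) : residue e ζ he (xS e ζ) = 0 := by
  simp [residue, toPowerSeries_xS]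

theorem residue_yS (he : 1 ≤ e) : residue e ζ he (yS e ζ) = 0 := by
  simp [residue, toPowerSeries_yS]

theorem residue_algebraMap (he : 1 ≤ e) (r : R) :
    residue e ζ he (algebraMap R (Salg e ζ) r) = MvPowerSeries.constantCoeff r := by
  simp [residue, toPowerSeries_algebraMap, constantCoeff_substHom]

end Salg

theorem lengthEq_iff_length_eq {R₀ M : Type} [Ring R₀] [AddCommGroup M] [Module R₀ M] {l : ℕ} :
    lengthEq R₀ M l ↔ Module.length R₀ M = l := by
  constructor
  · rintro ⟨s, h0, h1, rfl⟩
    exact (Module.length_compositionSeries s h0 h1).symm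
  · intro h
    obtain ⟨s, h0, h1⟩ := isFiniteLength_iff_exists_compositionSeries.1
      (Module.length_ne_top_iff.1 (h.trans_ne (ENat.natCast_ne_top l)))
    refine ⟨s, h0, h1, ?_⟩
    have := Module.length_compositionSeries s h0 h1
    rw [h] at this
    exact_mod_cast this

section MatrixModule

variable {f : ℕ} {S : Type} [Ring S]

theorem exists_mul_scalar {z : S} (hz : ∀ s, ∃ s', s * z = z * s') (a : Matrix (Fin f) (Fin f) S) :
    ∃ a' : Matrix (Fin f) (Fin f) S, a * Matrix.scalar (Fin f) z = Matrix.scalar (Fin f) z * a' := by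
  choose c hc using hz
  refine ⟨a.map c, ?_⟩
  ext i j
  simp [hc]

section Simple

variable {M : Type} [AddCommGroup M] [Module (Matrix (Fin f) (Fin f) S) M]

theorem scalar_smul_eq_zero_or_surjective [IsSimpleModule (Matrix (Fin f) (Fin f) S) M] {z : S}
    (hz : ∀ s, ∃ s', s * z = z * s') :
    (∀ m : M, Matrix.scalar (Fin f) z • m = 0) ∨
      ∀ m : M, ∃ m' : M, Matrix.scalar (Fin f) z • m' = m := by
  let N : Submodule (Matrix (Fin f) (Fin f) S) M :=
    { carrier := Set.range fun m : M => Matrix.scalar (Fin f) z • m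
      add_mem' := by
        rintro _ _ ⟨a, rfl⟩ ⟨b, rfl⟩
        exact ⟨a + b, smul_add _ _ _⟩
      zero_mem' := ⟨0, smul_zero _⟩
      smul_mem' := by
        rintro a _ ⟨m, rfl⟩
        obtain ⟨a', ha'⟩ := exists_mul_scalar hz a
        refine ⟨a' • m, ?_⟩
        simp only [← mul_smul]
        rw [ha'] }
  rcases eq_bot_or_eq_top N with h | h
  · left
    intro m
    have : Matrix.scalar (Fin f) z • m ∈ N := ⟨m, rfl⟩
    simpa [h] using this
  · right
    intro m
    have : m ∈ N := h ▸ Submodule.mem_top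
    exact this

theorem algebraMap_smul_eq_zero [Algebra R S] [Module.Finite R S]
    [IsSimpleModule (Matrix (Fin f) (Fin f) S) M] {r : R}
    (hr : MvPowerSeries.constantCoeff r = 0) (m : M) :
    algebraMap R (Matrix (Fin f) (Fin f) S) r • m = 0 := by
  rcases scalar_smul_eq_zero_or_surjective (f := f) (M := M) (z := algebraMap R S r)
    (fun s => ⟨s, Algebra.commutes r s |>.symm⟩) with h | h
  · exact h m
  let : Module R M := Module.compHom M (algebraMap R (Matrix (Fin f) (Fin f) S))
  have hsmul : ∀ (r : R) (m : M), r • m = algebraMap R (Matrix (Fin f) (Fin f) S) r • m :=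
    fun _ _ => rfl
  have : IsScalarTower R (Matrix (Fin f) (Fin f) S) M := ⟨fun r a m => by
    rw [hsmul, Algebra.smul_def, mul_smul]⟩
  have : Module.Finite R (Matrix (Fin f) (Fin f) S) :=
    inferInstanceAs (Module.Finite R (Fin f → Fin f → S))
  have : Module.Finite R M := Module.Finite.trans (Matrix (Fin f) (Fin f) S) M
  have hbot : (⊤ : Submodule R M) = ⊥ := by
    refine Submodule.eq_bot_of_le_smul_of_le_jacobson_bot (Ideal.span {r}) ⊤
      Module.Finite.fg_top (fun m _ => ?_) ?_
    · obtain ⟨m', rfl⟩ := h m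
      exact Submodule.smul_mem_smul (Ideal.mem_span_singleton_self r) (Submodule.mem_top (x := m'))
    · rw [IsLocalRing.jacobson_eq_maximalIdeal _ bot_ne_top, Ideal.span_singleton_le_iff_mem,
        IsLocalRing.mem_maximalIdeal, mem_nonunits_iff, MvPowerSeries.isUnit_iff_constantCoeff, hr]
      exact not_isUnit_zero
  have hm : m = 0 := by
    have : m ∈ (⊤ : Submodule R M) := Submodule.mem_top
    rwa [hbot, Submodule.mem_bot] at this
  rw [hm, smul_zero]

theorem algebraMap_smul_eq_of_constantCoeff_eq [Algebra R S] [Module.Finite R S]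
    [IsSimpleModule (Matrix (Fin f) (Fin f) S) M] {r r' : R}
    (h : MvPowerSeries.constantCoeff r = MvPowerSeries.constantCoeff r') (m : M) :
    algebraMap R (Matrix (Fin f) (Fin f) S) r • m =
      algebraMap R (Matrix (Fin f) (Fin f) S) r' • m := by
  rw [← sub_eq_zero, ← sub_smul, ← map_sub]
  exact algebraMap_smul_eq_zero (by rw [map_sub, h, sub_self]) m

theorem scalar_smul_eq_zero_of_pow_eq [Algebra R S] [Module.Finite R S]
    [IsSimpleModule (Matrix (Fin f) (Fin f) S) M]
    {z : S} (hz : ∀ s, ∃ s', s * z = z * s') {r : R} {n : ℕ}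
    (hzn : z ^ n = algebraMap R S r) (hr : MvPowerSeries.constantCoeff r = 0) (m : M) :
    Matrix.scalar (Fin f) z • m = 0 := by
  rcases scalar_smul_eq_zero_or_surjective (f := f) (M := M) hz with h | h
  · exact h m
  have hpow : ∀ (n : ℕ) (m : M), ∃ m' : M, Matrix.scalar (Fin f) (z ^ n) • m' = m := by
    intro n
    induction n with
    | zero => exact fun m => ⟨m, by simp⟩
    | succ n ih =>
      intro m
      obtain ⟨m₁, rfl⟩ := ih m
      obtain ⟨m₂, rfl⟩ := h m₁
      exact ⟨m₂, by rw [pow_succ, map_mul, mul_smul]⟩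
  have hm : ∀ m : M, m = 0 := fun m => by
    obtain ⟨m', rfl⟩ := hpow n m
    rw [hzn]
    exact algebraMap_smul_eq_zero hr m'
  exact hm _

end Simple

/-- The left ideal of matrices whose `j`-th column vanishes to order `k` under `S → ℂ⟦t⟧`. -/
def columnIdeal (φ : S →+* PowerSeries ℂ) (j : Fin f) (k : ℕ) :
    Submodule (Matrix (Fin f) (Fin f) S) (Matrix (Fin f) (Fin f) S) where
  carrier := {a | ∀ i, PowerSeries.X ^ k ∣ φ (a i j)}
  add_mem' ha hb i := by
    rw [Matrix.add_apply, map_add]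
    exact dvd_add (ha i) (hb i)
  zero_mem' i := by simp
  smul_mem' c a ha i := by
    rw [smul_eq_mul, Matrix.mul_apply, map_sum]
    refine Finset.dvd_sum fun n _ => ?_
    rw [map_mul]
    exact (ha n).mul_left _

theorem mem_columnIdeal {φ : S →+* PowerSeries ℂ} {j : Fin f} {k : ℕ}
    {a : Matrix (Fin f) (Fin f) S} :
    a ∈ columnIdeal φ j k ↔
      ∀ i, PowerSeries.X ^ k ∣ φ (a i j) := Iff.rfl

theorem mem_columnIdeal_one {φ : S →+* PowerSeries ℂ} {j : Fin f} {a : Matrix (Fin f) (Fin f) S} :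
    a ∈ columnIdeal φ j 1 ↔ ∀ i, PowerSeries.constantCoeff (φ (a i j)) = 0 := by
  simp [mem_columnIdeal, PowerSeries.X_dvd_iff]

theorem single_smul_eq {M : Type} [AddCommGroup M] [Module (Matrix (Fin f) (Fin f) S) M]
    (i j : Fin f) (s : S) (m : M) : (Matrix.single i j s : Matrix (Fin f) (Fin f) S) • m =
      Matrix.scalar (Fin f) s • (Matrix.single i j 1 : Matrix (Fin f) (Fin f) S) • m := by
  rw [← mul_smul]
  congr 1
  ext a b
  simp [Matrix.single_apply]

theorem nonempty_linearEquiv_quotient_columnIdeal [Algebra R S]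
    (φ : S →+* PowerSeries ℂ) (j : Fin f)
    (M : Type) [AddCommGroup M] [Module (Matrix (Fin f) (Fin f) S) M]
    [IsSimpleModule (Matrix (Fin f) (Fin f) S) M]
    (hres : ∀ (s : S) (m : M), Matrix.scalar (Fin f) s • m =
      algebraMap R (Matrix (Fin f) (Fin f) S)
        (algebraMap ℂ R (PowerSeries.constantCoeff (φ s))) • m) :
    Nonempty ((Matrix (Fin f) (Fin f) S ⧸ columnIdeal φ j 1) ≃ₗ[Matrix (Fin f) (Fin f) S] M) := by
  have := IsSimpleModule.nontrivial (Matrix (Fin f) (Fin f) S) M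
  obtain ⟨m₀, hm₀⟩ := exists_ne (0 : M)
  obtain ⟨i, hi⟩ : ∃ i, (Matrix.single j i 1 : Matrix (Fin f) (Fin f) S) • m₀ ≠ 0 := by
    by_contra! h
    apply hm₀
    rw [← one_smul (Matrix (Fin f) (Fin f) S) m₀,
      Matrix.matrix_eq_sum_single (1 : Matrix (Fin f) (Fin f) S),
      Finset.sum_smul]
    refine Finset.sum_eq_zero fun a _ => ?_
    rw [Finset.sum_smul]
    refine Finset.sum_eq_zero fun b _ => ?_
    have hab : (Matrix.single a b ((1 : Matrix (Fin f) (Fin f) S) a b) : Matrix (Fin f) (Fin f) S) =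
        Matrix.single a j ((1 : Matrix (Fin f) (Fin f) S) a b) * Matrix.single j b 1 := by
      rw [Matrix.single_mul_single_same, mul_one]
    rw [hab, mul_smul, h, smul_zero]
  set m := (Matrix.single j i 1 : Matrix (Fin f) (Fin f) S) • m₀ with hm
  have hjm : ∀ a : Matrix (Fin f) (Fin f) S,
      a • m = ∑ n, (Matrix.single n j (a n j) : Matrix (Fin f) (Fin f) S) • m := by
    intro a
    rw [hm, ← Finset.sum_smul, ← mul_smul, ← mul_smul, Finset.sum_mul]
    congr 1
    simp only [Matrix.single_mul_single_same, mul_one]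
    ext p q
    simp [Matrix.sum_apply, Matrix.mul_apply, Matrix.single_apply, ite_and]
  have hker : LinearMap.ker (LinearMap.toSpanSingleton (Matrix (Fin f) (Fin f) S) M m) =
      columnIdeal φ j 1 := by
    ext a
    rw [LinearMap.mem_ker, LinearMap.toSpanSingleton_apply, mem_columnIdeal_one]
    constructor
    · intro ha n
      by_contra hn
      have hjj : (Matrix.single j j 1 : Matrix (Fin f) (Fin f) S) • m = m := by
        rw [hm, ← mul_smul, Matrix.single_mul_single_same, mul_one]
      have h0 : (Matrix.single j j (a n j) : Matrix (Fin f) (Fin f) S) • m = 0 := by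
        have hmul : (Matrix.single j j (a n j) : Matrix (Fin f) (Fin f) S) =
            Matrix.single j n 1 * a * Matrix.single j j 1 := by
          ext p q
          simp only [Matrix.mul_apply, Matrix.single_apply, ite_and]
          simp
          split_ifs <;> rfl
        rw [hmul, mul_smul, hjj, mul_smul, ha, smul_zero]
      rw [single_smul_eq, hjj, hres] at h0
      apply hi
      have := congrArg (fun m : M => algebraMap R (Matrix (Fin f) (Fin f) S)
        (algebraMap ℂ R (PowerSeries.constantCoeff (φ (a n j)))⁻¹) • m) h0
      simpa only [smul_zero, ← mul_smul, ← map_mul, inv_mul_cancel₀ hn, map_one, one_smul]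
        using this
    · intro ha
      rw [hjm]
      refine Finset.sum_eq_zero fun n _ => ?_
      rw [single_smul_eq, hres, ha, map_zero, map_zero, zero_smul]
  rw [← hker]
  exact ⟨LinearMap.quotKerEquivOfSurjective _ (IsSimpleModule.toSpanSingleton_surjective _ hi)⟩

theorem length_pi_complex (f : ℕ) :
    letI : Module R ℂ := Module.compHom ℂ (MvPowerSeries.constantCoeff (σ := Fin 2) (R := ℂ))
    Module.length R (Fin f → ℂ) = f := by
  let : Algebra R ℂ := (MvPowerSeries.constantCoeff (σ := Fin 2) (R := ℂ)).toAlgebra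
  have hs : Function.Surjective (algebraMap R ℂ) := fun c =>
    ⟨MvPowerSeries.C c, MvPowerSeries.constantCoeff_C c⟩
  change Module.length R (Fin f → ℂ) = f
  rw [Module.length_pi, Module.length_eq_of_surjective (R := ℂ) hs, Module.length_eq_one]
  simp

theorem columnIdeal_succ_le (φ : S →+* PowerSeries ℂ) (j : Fin f) (k : ℕ) :
    columnIdeal φ j (k + 1) ≤ columnIdeal φ j k :=
  fun _ ha i => (pow_dvd_pow _ k.le_succ).trans (ha i)

theorem length_quotient_columnIdeal_succ [Algebra R S] {φ : S →+* PowerSeries ℂ} {t : S}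
    (ht : φ t = PowerSeries.X)
    (hφ : ∀ r : R, PowerSeries.constantCoeff (φ (algebraMap R S r)) =
      MvPowerSeries.constantCoeff r) (j : Fin f) (k : ℕ) :
    Module.length R (Matrix (Fin f) (Fin f) S ⧸ columnIdeal φ j (k + 1)) =
      f + Module.length R (Matrix (Fin f) (Fin f) S ⧸ columnIdeal φ j k) := by
  let : Module R ℂ := Module.compHom ℂ (MvPowerSeries.constantCoeff (σ := Fin 2) (R := ℂ))
  have hsmul : ∀ (r : R) (c : ℂ), r • c = MvPowerSeries.constantCoeff r * c := fun _ _ => rfl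
  let w : (Fin f → ℂ) → Matrix (Fin f) (Fin f) S := fun c =>
    Matrix.of fun i j' => if j' = j then algebraMap R S (algebraMap ℂ R (c i)) * t ^ k else 0
  have hw : ∀ c i, w c i j = algebraMap R S (algebraMap ℂ R (c i)) * t ^ k := by simp [w]
  have hcoeff : ∀ c : ℂ, PowerSeries.constantCoeff (φ (algebraMap R S (algebraMap ℂ R c))) = c :=
    fun c => by simp [hφ, MvPowerSeries.algebraMap_apply]
  let g : (Fin f → ℂ) →ₗ[R] Matrix (Fin f) (Fin f) S ⧸ columnIdeal φ j (k + 1) :=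
    { toFun := fun c => Submodule.Quotient.mk (w c)
      map_add' := fun c d => by
        rw [← Submodule.Quotient.mk_add]
        congr 1
        ext i j'
        by_cases h : j' = j <;> simp [w, h, add_mul]
      map_smul' := fun r c => by
        rw [RingHom.id_apply, ← Submodule.Quotient.mk_smul, Submodule.Quotient.eq]
        intro i
        rw [Matrix.sub_apply, Matrix.smul_apply, hw, hw, Algebra.smul_def, ← mul_assoc, ← sub_mul,
          map_mul, map_pow, ht, mul_comm, pow_succ]
        refine mul_dvd_mul_left _ (PowerSeries.X_dvd_iff.2 ?_)
        rw [map_sub, map_sub, map_mul, map_mul, hcoeff, hcoeff, hφ, Pi.smul_apply, hsmul, sub_self] }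
  have hg : ∀ c, g c = Submodule.Quotient.mk (w c) := fun _ => rfl
  let F := Submodule.factor (columnIdeal_succ_le φ j k)
  have hF : ∀ a, F (Submodule.Quotient.mk a) = Submodule.Quotient.mk a := fun _ => rfl
  have key := Module.length_eq_add_of_exact g
    (F.restrictScalars R) ?_ ?_ ?_
  · rw [key]
    congr 1
    exact length_pi_complex f
  · rw [injective_iff_map_eq_zero]
    intro c hc
    rw [hg, Submodule.Quotient.mk_eq_zero] at hc
    funext i
    have := hc i
    rw [hw, map_mul, map_pow, ht, mul_comm, pow_succ,
      mul_dvd_mul_iff_left (pow_ne_zero _ PowerSeries.X_ne_zero), PowerSeries.X_dvd_iff,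
      hcoeff] at this
    exact this
  · exact Submodule.factor_surjective (columnIdeal_succ_le φ j k)
  · intro q
    obtain ⟨a, rfl⟩ := Submodule.Quotient.mk_surjective _ q
    rw [LinearMap.restrictScalars_apply, hF, Submodule.Quotient.mk_eq_zero]
    constructor
    · intro ha
      choose b hb using ha
      refine ⟨fun i => PowerSeries.constantCoeff (b i), ?_⟩
      rw [hg, Submodule.Quotient.eq]
      intro i
      rw [Matrix.sub_apply, hw, map_sub, map_mul, map_pow, ht, hb, mul_comm, ← mul_sub, pow_succ]
      refine mul_dvd_mul_left _ (PowerSeries.X_dvd_iff.2 ?_)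
      rw [map_sub, hcoeff, sub_self]
    · rintro ⟨c, hc⟩ i
      rw [hg, Submodule.Quotient.eq] at hc
      have h1 := columnIdeal_succ_le φ j k hc i
      rw [Matrix.sub_apply, map_sub] at h1
      refine (dvd_sub_right ?_).1 h1
      rw [hw, map_mul, map_pow, ht]
      exact dvd_mul_left _ _

theorem length_quotient_columnIdeal [Algebra R S] {φ : S →+* PowerSeries ℂ} {t : S}
    (ht : φ t = PowerSeries.X)
    (hφ : ∀ r : R, PowerSeries.constantCoeff (φ (algebraMap R S r)) =
      MvPowerSeries.constantCoeff r) (j : Fin f) (k : ℕ) :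
    Module.length R (Matrix (Fin f) (Fin f) S ⧸ columnIdeal φ j k) = (f * k : ℕ) := by
  induction k with
  | zero =>
    have : columnIdeal φ j 0 = ⊤ := eq_top_iff.2 fun a _ i => by simp
    rw [this, mul_zero, Nat.cast_zero, Module.length_eq_zero_iff]
    exact Submodule.Quotient.subsingleton_iff.2 rfl
  | succ k ih =>
    rw [length_quotient_columnIdeal_succ ht hφ, ih]
    push_cast
    ring

end MatrixModule

theorem IsFiniteLength.exists_length_eq_mul {A : Type} [Ring A] [Algebra R A] {f : ℕ}
    (hA : ∀ (M : Type) [AddCommGroup M] [Module A M] [Module R M] [IsScalarTower R A M],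
      IsSimpleModule A M → Module.length R M = f)
    {M : Type} [AddCommGroup M] [Module A M] (h : IsFiniteLength A M) :
    ∀ [Module R M] [IsScalarTower R A M], ∃ k : ℕ, Module.length R M = (f * k : ℕ) := by
  induction h with
  | of_subsingleton =>
    intro _ _
    exact ⟨0, by simp⟩
  | @of_simple_quotient M _ _ N hN _ ih =>
    intro _ _
    obtain ⟨k, hk⟩ := ih
    refine ⟨k + 1, ?_⟩
    rw [Module.length_eq_add_of_exact (N.subtype.restrictScalars R) (N.mkQ.restrictScalars R)
      (Submodule.injective_subtype N) (Submodule.mkQ_surjective N)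
      (LinearMap.exact_subtype_mkQ N), hk, hA (M ⧸ N) hN]
    push_cast
    ring

namespace ASalg

variable {e f : ℕ} {ζ : ℂ} {M : Type} [AddCommGroup M] [Module (ASalg e ζ f) M]

theorem scalar_smul_eq_residue_smul (he : 1 ≤ e) (hζ : ζ ≠ 0) [IsSimpleModule (ASalg e ζ f) M]
    (s : Salg e ζ) (m : M) : Matrix.scalar (Fin f) s • m =
      algebraMap R (ASalg e ζ f) (algebraMap ℂ R (Salg.residue e ζ he s)) • m := by
  have := Salg.finite (ζ := ζ) he
  induction s using Salg.induction generalizing m with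
  | hr r =>
    exact algebraMap_smul_eq_of_constantCoeff_eq (S := Salg e ζ)
      (by rw [Salg.residue_algebraMap, MvPowerSeries.algebraMap_apply,
        MvPowerSeries.constantCoeff_C, Algebra.algebraMap_self_apply]) m
  | hx =>
    rw [Salg.residue_xS, map_zero, map_zero, zero_smul]
    exact scalar_smul_eq_zero_of_pow_eq (S := Salg e ζ) Salg.exists_mul_xS Salg.xS_pow
      (MvPowerSeries.constantCoeff_X 0) m
  | hy =>
    rw [Salg.residue_yS, map_zero, map_zero, zero_smul]
    exact scalar_smul_eq_zero_of_pow_eq (S := Salg e ζ) (Salg.exists_mul_yS hζ) Salg.yS_pow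
      (MvPowerSeries.constantCoeff_X 1) m
  | hadd a b ha hb => simp only [map_add, add_smul, ha, hb]
  | hmul a b ha hb => simp only [map_mul, mul_smul, ha, hb]

theorem nonempty_linearEquiv (he : 1 ≤ e) (hζ : ζ ≠ 0) (j : Fin f)
    (hM : IsSimpleModule (ASalg e ζ f) M) :
    Nonempty ((ASalg e ζ f ⧸ columnIdeal (S := Salg e ζ) (Salg.toPowerSeries e ζ he) j 1)
      ≃ₗ[ASalg e ζ f] M) :=
  nonempty_linearEquiv_quotient_columnIdeal (S := Salg e ζ) _ j M (scalar_smul_eq_residue_smul he hζ)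

theorem length_quotient (he : 1 ≤ e) (j : Fin f) (k : ℕ) :
    Module.length R (ASalg e ζ f ⧸ columnIdeal (S := Salg e ζ) (Salg.toPowerSeries e ζ he) j k) =
      (f * k : ℕ) :=
  length_quotient_columnIdeal (S := Salg e ζ) (Salg.toPowerSeries_xS he)
    (Salg.residue_algebraMap he) j k

theorem length_of_isSimpleModule (he : 1 ≤ e) (hζ : ζ ≠ 0) (j : Fin f)
    [Module R M] [IsScalarTower R (ASalg e ζ f) M]
    (hM : IsSimpleModule (ASalg e ζ f) M) : Module.length R M = f := by
  obtain ⟨g⟩ := nonempty_linearEquiv he hζ j hM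
  rw [← (g.restrictScalars R).length_eq, length_quotient, mul_one]

end ASalg

/-!
STATEMENT 16: For `A = M_f(S)`, there is a left ideal `I ⊆ A` with `A/I` of finite length
`l` as an `R`-module iff `f ∣ l`; moreover every simple left `A`-module has length exactly
`f` as an `R`-module, and any two simple left `A`-modules are isomorphic.
-/

theorem hilb_and_simple_modules_of_ASalg (e f : ℕ) (he : 1 ≤ e) (hf : 1 ≤ f)
    (ζ : ℂ) (hζ : IsPrimitiveRoot ζ e) (l : ℕ) :
    ((∃ I : Submodule (ASalg e ζ f) (ASalg e ζ f),
      lengthEq R (ASalg e ζ f ⧸ I) l) ↔ f ∣ l) ∧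
    (∀ (M : Type) [AddCommGroup M] [Module (ASalg e ζ f) M]
        [Module R M] [IsScalarTower R (ASalg e ζ f) M],
      IsSimpleModule (ASalg e ζ f) M → lengthEq R M f) ∧
    (∀ (M N : Type) [AddCommGroup M] [Module (ASalg e ζ f) M]
        [AddCommGroup N] [Module (ASalg e ζ f) N],
      IsSimpleModule (ASalg e ζ f) M → IsSimpleModule (ASalg e ζ f) N →
        Nonempty (M ≃ₗ[ASalg e ζ f] N)) := by
  have hζ0 : ζ ≠ 0 := hζ.ne_zero (Nat.one_le_iff_ne_zero.1 he)
  let j : Fin f := ⟨0, hf⟩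
  refine ⟨⟨?_, ?_⟩, ?_, ?_⟩
  · rintro ⟨I, hI⟩
    have hI := lengthEq_iff_length_eq.1 hI
    have hfin := isFiniteLength_iff_isNoetherian_isArtinian.1
      (Module.length_ne_top_iff.1 (hI.trans_ne (ENat.natCast_ne_top l)))
    have hN : IsNoetherian (ASalg e ζ f) (ASalg e ζ f ⧸ I) := isNoetherian_of_tower R hfin.1
    have hA : IsArtinian (ASalg e ζ f) (ASalg e ζ f ⧸ I) := isArtinian_of_tower R hfin.2
    obtain ⟨k, hk⟩ := IsFiniteLength.exists_length_eq_mul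
      (fun M _ _ _ _ hM => ASalg.length_of_isSimpleModule he hζ0 j hM)
      (isFiniteLength_iff_isNoetherian_isArtinian.2 ⟨hN, hA⟩)
    refine ⟨k, ?_⟩
    rw [hI] at hk
    exact_mod_cast hk
  · rintro ⟨k, rfl⟩
    exact ⟨columnIdeal (S := Salg e ζ) (Salg.toPowerSeries e ζ he) j k,
      lengthEq_iff_length_eq.2 (ASalg.length_quotient he j k)⟩
  · intro M _ _ _ _ hM
    exact lengthEq_iff_length_eq.2 (ASalg.length_of_isSimpleModule he hζ0 j hM)
  · intro M N _ _ _ _ hM hN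
    obtain ⟨g⟩ := ASalg.nonempty_linearEquiv he hζ0 j hM
    obtain ⟨h⟩ := ASalg.nonempty_linearEquiv he hζ0 j hN
    exact ⟨g.symm.trans h⟩

end
end
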